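/- Let V = (V, Y(·,z), 𝟏) be a ℤ-graded vertex algebra, G a group of automorphisms of V preserving the ℤ-grading, and χ a linear character of G. Then the (G,χ)-equivariant quasi V-modules (W, Y_W) are exactly the (G,χ)-equivariant φ-coordinated quasi modules (W, Y_W^φ) for the vertex algebra (V, Y[·,z], 𝟏), under the correspondence Y_W^φ(v,z) = Y_W(z^{L(0)}v, z) for all v ∈ V, where Y[v,z] = Y(e^{zL(0)}v, e^z − 1). -/

import Mathlib

noncomputable section
open scoped BigOperators

/-- The generalized binomial coefficient `binom(m, i) = m(m-1)⋯(m-i+1)/i!` as a complex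
number, for `m : ℤ`. -/
def intChoose (m : ℤ) (i : ℕ) : ℂ :=
  (∏ j ∈ Finset.range i, ((m : ℂ) - (j : ℂ))) / (Nat.factorial i : ℂ)

/-- A vertex algebra over `ℂ`, presented through its modes: `Y v n` is the operator `v_n`,
so that `Y(v,z) = ∑_{n ∈ ℤ} v_n z^{-n-1}`. -/
structure VertexAlg (V : Type) [AddCommGroup V] [Module ℂ V] where
  /-- the modes `v ↦ vₙ` of the vertex operator `Y(v,z) = ∑ₙ vₙ z^{-n-1}` -/
  Y : V → ℤ → Module.End ℂ V
  /-- the vacuum vector -/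
  one : V
  Y_add : ∀ u v n, Y (u + v) n = Y u n + Y v n
  Y_smul : ∀ (c : ℂ) u n, Y (c • u) n = c • Y u n
  /-- lower truncation: `uₙ v = 0` for `n` sufficiently large -/
  trunc : ∀ u v, ∃ N : ℤ, ∀ n, N ≤ n → Y u n v = 0
  /-- `Y(𝟏, z) = id` -/
  vacuum_Y : ∀ n, Y one n = if n = -1 then 1 else 0
  /-- creation: `Y(v,z)𝟏 ∈ V[[z]]` -/
  create : ∀ v n, 0 ≤ n → Y v n one = 0
  /-- creation: `Y(v,z)𝟏|_{z=0} = v` -/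
  create_neg_one : ∀ v, Y v (-1) one = v
  /-- the Borcherds (Jacobi) identity in coefficient form -/
  borcherds : ∀ u v w : V, ∀ m n k : ℤ,
    (∑ᶠ i : ℕ, intChoose m i • Y (Y u (n + i) v) (m + k - i) w) =
      ∑ᶠ i : ℕ, ((-1 : ℂ) ^ i * intChoose n i) •
        (Y u (m + n - i) (Y v (k + i) w)
          - ((-1 : ℂ) ^ n) • Y v (n + k - i) (Y u (m + i) w))

namespace VertexAlg

variable {V : Type} [AddCommGroup V] [Module ℂ V]

/-- the canonical derivation `𝒟 v = v₋₂𝟏` of a vertex algebra -/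
def D (VA : VertexAlg V) (v : V) : V := VA.Y v (-2) VA.one

/-- a linear automorphism of `V` is an automorphism of the vertex algebra `VA` if it fixes the
vacuum and intertwines all modes. -/
def IsAuto (VA : VertexAlg V) (g : V ≃ₗ[ℂ] V) : Prop :=
  g VA.one = VA.one ∧ ∀ u n v, g (VA.Y u n v) = VA.Y (g u) n (g v)

/-- an ideal of a vertex algebra: a subspace stable under left and right modes. -/
def IsIdeal (VA : VertexAlg V) (I : Submodule ℂ V) : Prop :=
  ∀ u ∈ I, ∀ (v : V) (n : ℤ), VA.Y u n v ∈ I ∧ VA.Y v n u ∈ I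

/-- a vertex algebra is simple if its only ideals are `⊥` and `⊤`. -/
def IsSimpleVA (VA : VertexAlg V) : Prop :=
  ∀ I : Submodule ℂ V, IsIdeal VA I → I = ⊥ ∨ I = ⊤

end VertexAlg

/-- Coefficient of `z₁^m z₂^k` in `f(z₁/z₂) A(z₁) B(z₂)`, where `A(z) = ∑ₙ (A n) zⁿ`,
`B(z) = ∑ₙ (B n) zⁿ` are fields written with `n`-th coefficient convention. -/
def pCoeff2 {W : Type} [AddCommGroup W] [Module ℂ W]
    (A B : ℤ → Module.End ℂ W) (f : Polynomial ℂ) (m k : ℤ) :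
    Module.End ℂ W :=
  ∑ i ∈ f.support, f.coeff i • (A (m - i) * B (k + i))

/-- coefficient of `z^s` in `e^{i z}` -/
def expC (i : ℕ) (s : ℤ) : ℂ :=
  if 0 ≤ s then (i : ℂ) ^ s.toNat / (Nat.factorial s.toNat : ℂ) else 0

/-- coefficient of `z₀^r` in `e^{m z₀}` (the substitution `z₁ = z₂ e^{z₀}` applied to `z₁^m`
produces `z₂^m e^{m z₀}`). -/
def subC (m : ℤ) (r : ℤ) : ℂ :=
  if 0 ≤ r then (m : ℂ) ^ r.toNat / (Nat.factorial r.toNat : ℂ) else 0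

/-- A `(G,χ)`-equivariant `φ`-coordinated quasi module for a vertex algebra `VA`, where
`φ(z₂,z₀) = z₂ e^{z₀}`.  The field `Y_W^φ(v,z)` is recorded through its coefficients:
`Y_W^φ(v,z) = ∑_{n ∈ ℤ} (E v n) zⁿ`. -/
structure PhiMod {V : Type} [AddCommGroup V] [Module ℂ V] (VA : VertexAlg V)
    {G : Type} [Group G] (ρ : G →* (V ≃ₗ[ℂ] V)) (χ : G →* ℂˣ)
    (W : Type) [AddCommGroup W] [Module ℂ W] where
  /-- `E v n` is the coefficient of `zⁿ` in `Y_W^φ(v, z)` -/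
  E : V → ℤ → Module.End ℂ W
  E_add : ∀ u v n, E (u + v) n = E u n + E v n
  E_smul : ∀ (c : ℂ) v n, E (c • v) n = c • E v n
  /-- `Y_W^φ(v,z) ∈ Hom(W, W((z)))` -/
  lower_trunc : ∀ v w, ∃ N : ℤ, ∀ n, n < N → E v n w = 0
  /-- `Y_W^φ(𝟏,z) = 1_W` -/
  vacuum : ∀ n, E VA.one n = if n = 0 then 1 else 0
  /-- `Y_W^φ(gv, z) = Y_W^φ(v, χ(g)z)` -/
  equivar : ∀ (g : G) (v : V) (n : ℤ), E (ρ g v) n = (((χ g : ℂ)) ^ n) • E v n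
  /-- for all `u,v` there is `f ∈ ℂ_{χ(G)}[z]` such that
  `f(z₁/z₂) Y^φ(u,z₁) Y^φ(v,z₂) ∈ Hom(W, W((z₁,z₂)))` and
  `f(e^{z₀}) Y^φ(Y(u,z₀)v, z₂) = (f(z₁/z₂)Y^φ(u,z₁)Y^φ(v,z₂))|_{z₁ = z₂e^{z₀}}`,
  both written out in coefficients (of `z₁^m z₂^k`, resp. of `z₀^r z₂^n`). -/
  assoc : ∀ u v : V, ∃ f : Polynomial ℂ, f ≠ 0 ∧
    (∀ c : ℂ, f.IsRoot c → ∃ g : G, ((χ g : ℂ)) = c) ∧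
    (∀ w : W, ∃ N : ℤ, ∀ m k : ℤ, (m < N ∨ k < N) →
      pCoeff2 (E u) (E v) f m k w = 0) ∧
    (∀ (r n : ℤ) (w : W),
      (∑ᶠ j : ℤ, (∑ i ∈ f.support, f.coeff i * expC i (r + j + 1)) • E (VA.Y u j v) n w)
        = ∑ᶠ m : ℤ, subC m r • pCoeff2 (E u) (E v) f m (n - m) w)

/-- a `(G,χ)`-equivariant `φ`-coordinated quasi module `(W, Y_W^φ, d)`: additionally an
endomorphism `d` with `[d, Y_W^φ(v,z)] = Y_W^φ(𝒟v, z)`. -/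
structure PhiModD {V : Type} [AddCommGroup V] [Module ℂ V] (VA : VertexAlg V)
    {G : Type} [Group G] (ρ : G →* (V ≃ₗ[ℂ] V)) (χ : G →* ℂˣ)
    (W : Type) [AddCommGroup W] [Module ℂ W] extends PhiMod VA ρ χ W where
  d : Module.End ℂ W
  d_comm : ∀ (v : V) (n : ℤ), d * E v n - E v n * d = E (VA.D v) n

end
noncomputable section

/-- A `ℤ`-graded vertex algebra: a vertex algebra together with grading projections
`proj n` onto the homogeneous components `V_(n)`, with `𝟏 ∈ V_(0)` and
`u_m V_(n) ⊆ V_(n+k-m-1)` for `u ∈ V_(k)`. -/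
structure GradedVA (V : Type) [AddCommGroup V] [Module ℂ V] extends VertexAlg V where
  proj : ℤ → Module.End ℂ V
  proj_comp : ∀ h k, proj h * proj k = if h = k then proj h else 0
  proj_finite : ∀ v, {h : ℤ | proj h v ≠ 0}.Finite
  proj_sum : ∀ v, (∑ᶠ h : ℤ, proj h v) = v
  one_deg : proj 0 one = one
  Y_deg : ∀ (k n m : ℤ) (u v : V), proj k u = u → proj n v = v →
    proj (n + k - m - 1) (Y u m v) = Y u m v

/-- A `(G,χ)`-equivariant quasi module `(W, Y_W)` for a `ℤ`-graded vertex algebra, in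
coefficient form: `Y_W(v,z) = ∑ₙ (A v n) zⁿ`.  Condition (ii) reads
`Y_W(χ(g)^{-L(0)} g v, z) = Y_W(v, χ(g) z)`, and in condition (iii) the substitution is
`z₁ = z₂ + z₀` (expanded in nonnegative powers of `z₀`). -/
structure QuasiMod {V : Type} [AddCommGroup V] [Module ℂ V] (VA : GradedVA V)
    {G : Type} [Group G] (ρ : G →* (V ≃ₗ[ℂ] V)) (χ : G →* ℂˣ)
    (W : Type) [AddCommGroup W] [Module ℂ W] where
  A : V → ℤ → Module.End ℂ W
  A_add : ∀ u v n, A (u + v) n = A u n + A v n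
  A_smul : ∀ (c : ℂ) v n, A (c • v) n = c • A v n
  lower_trunc : ∀ v w, ∃ N : ℤ, ∀ n, n < N → A v n w = 0
  vacuum : ∀ n, A VA.one n = if n = 0 then 1 else 0
  equivar : ∀ (g : G) (v : V) (h n : ℤ), VA.proj h v = v →
    A (ρ g v) n = (((χ g : ℂ)) ^ (n + h)) • A v n
  assoc : ∀ u v : V, ∃ f : Polynomial ℂ, f ≠ 0 ∧
    (∀ c : ℂ, f.IsRoot c → ∃ g : G, ((χ g : ℂ)) = c) ∧
    (∀ w : W, ∃ N : ℤ, ∀ m k : ℤ, (m < N ∨ k < N) →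
      pCoeff2 (A u) (A v) f m k w = 0) ∧
    (∀ (k n : ℤ) (w : W),
      (∑ i ∈ f.support, f.coeff i •
        (∑ s ∈ Finset.range (i + 1), ((i.choose s : ℂ)) •
          A (VA.Y u ((s : ℤ) - k - 1) v) (n + s) w))
      = if 0 ≤ k then
          ∑ᶠ m : ℤ, intChoose m k.toNat • pCoeff2 (A u) (A v) f m (n - m + k) w
        else 0)

end

noncomputable section

/-- the coefficient of `z^k` in `e^{hz} (e^z - 1)^{-m-1}`, computed in Laurent series;
these are the structure constants of the Zhu transform `Y[v,z] = Y(e^{zL(0)}v, e^z - 1)`. -/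
def tcoef (h m k : ℤ) : ℂ :=
  ((HahnSeries.ofPowerSeries ℤ ℂ (PowerSeries.rescale (h : ℂ) (PowerSeries.exp ℂ)))
      * ((HahnSeries.ofPowerSeries ℤ ℂ (PowerSeries.exp ℂ)) - 1) ^ (-m - 1 : ℤ)).coeff k


section LaurentSeriesSubstitution

open HahnSeries LaurentSeries

theorem intChoose_zero_right (m : ℤ) : intChoose m 0 = 1 := by
  simp [intChoose]

theorem intChoose_succ_succ (m : ℤ) (k : ℕ) :
    intChoose (m + 1) (k + 1) = intChoose m k + intChoose m (k + 1) := by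
  have h : ∏ j ∈ Finset.range (k + 1), (((m + 1 : ℤ) : ℂ) - (j : ℂ))
      = (∏ j ∈ Finset.range k, ((m : ℂ) - (j : ℂ))) * (m + 1) := by
    rw [Finset.prod_range_succ']
    push_cast
    congr 1
    · exact Finset.prod_congr rfl fun j _ => by ring
    · ring
  have hk : (k.factorial : ℂ) ≠ 0 := by exact_mod_cast k.factorial_ne_zero
  have hk' : (k : ℂ) + 1 ≠ 0 := by exact_mod_cast k.succ_ne_zero
  rw [intChoose, h, intChoose, intChoose, Finset.prod_range_succ, Nat.factorial_succ]
  push_cast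
  field_simp
  ring

theorem zpow_of_succ {K : Type*} [Field K] {U : K} (hU : U ≠ 0) (F : ℤ → K) (h0 : F 0 = 1)
    (hF : ∀ m, F (m + 1) = F m * U) (m : ℤ) : F m = U ^ m := by
  induction m using Int.induction_on with
  | zero => simpa using h0
  | succ n ih => rw [hF, ih, zpow_add_one₀ hU]
  | pred n ih =>
    have := hF (-(n : ℤ) - 1)
    rw [sub_add_cancel, ih] at this
    rw [zpow_sub_one₀ hU, this, mul_assoc, mul_inv_cancel₀ hU, mul_one]

/-- The Laurent series `1 + t`. -/
def onePlusT : LaurentSeries ℂ := 1 + single 1 1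

/-- The exponential series `e^z` as a Laurent series. -/
def expL : LaurentSeries ℂ := HahnSeries.ofPowerSeries ℤ ℂ (PowerSeries.exp ℂ)

theorem coeff_ofPowerSeries_int (P : PowerSeries ℂ) (k : ℤ) :
    (ofPowerSeries ℤ ℂ P).coeff k = if 0 ≤ k then PowerSeries.coeff k.toNat P else 0 := by
  have := PowerSeries.coeff_coe P k
  rw [this]
  split_ifs with h1 h2 h2
  · omega
  · rfl
  · congr 1
    congr 1
    omega
  · omega

theorem onePlusT_eq : onePlusT = ofPowerSeries ℤ ℂ (1 + PowerSeries.X) := by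
  simp [onePlusT]

theorem onePlusT_ne_zero : onePlusT ≠ 0 := by
  intro h
  have := congrArg (fun X => X.coeff 0) h
  simp [onePlusT] at this

theorem expL_ne_zero : expL ≠ 0 := by
  intro h
  have := congrArg (fun X => X.coeff 0) h
  simp [expL, coeff_ofPowerSeries_int] at this

theorem coeff_onePlusT_zpow (m k : ℤ) :
    (onePlusT ^ m).coeff k = if 0 ≤ k then intChoose m k.toNat else 0 := by
  rw [← zpow_of_succ onePlusT_ne_zero
    (fun m => ofPowerSeries ℤ ℂ (PowerSeries.mk (intChoose m))) ?_ ?_ m]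
  · rw [coeff_ofPowerSeries_int, PowerSeries.coeff_mk]
  · rw [← map_one (ofPowerSeries ℤ ℂ)]
    congr 1
    ext n
    cases n with
    | zero => simp [intChoose]
    | succ n => simp [intChoose, PowerSeries.coeff_one, Finset.prod_range_succ']
  · intro m
    rw [onePlusT_eq, ← map_mul]
    congr 1
    ext n
    cases n with
    | zero => simp [intChoose_zero_right, mul_add]
    | succ n =>
      simp [intChoose_succ_succ, mul_add, PowerSeries.coeff_succ_mul_X, add_comm]

theorem expL_zpow (m : ℤ) :
    expL ^ m = ofPowerSeries ℤ ℂ (PowerSeries.rescale (m : ℂ) (PowerSeries.exp ℂ)) := by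
  rw [← zpow_of_succ expL_ne_zero
    (fun m => ofPowerSeries ℤ ℂ (PowerSeries.rescale (m : ℂ) (PowerSeries.exp ℂ))) ?_ ?_ m]
  · rw [← map_one (ofPowerSeries ℤ ℂ)]
    congr 1
    simp [PowerSeries.rescale_zero]
  · intro m
    have h := PowerSeries.exp_mul_exp_eq_exp_add (m : ℂ) (1 : ℂ)
    rw [PowerSeries.rescale_one, RingHom.id_apply] at h
    rw [expL, ← map_mul, h]
    push_cast
    rfl

theorem coeff_expL_zpow (m k : ℤ) : (expL ^ m).coeff k = subC m k := by
  rw [expL_zpow, coeff_ofPowerSeries_int, subC]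
  split_ifs
  · simp [PowerSeries.coeff_rescale, PowerSeries.coeff_exp, div_eq_mul_inv]
  · rfl

theorem expC_eq_subC (i : ℕ) (s : ℤ) : expC i s = subC i s := by
  simp [expC, subC]

theorem tcoef_eq (h m k : ℤ) : tcoef h m k = (expL ^ h * (expL - 1) ^ (-m - 1)).coeff k := by
  rw [expL_zpow]
  rfl

theorem coeff_finset_sum {ι : Type*} (S : Finset ι) (F : ι → LaurentSeries ℂ) (k : ℤ) :
    (∑ i ∈ S, F i).coeff k = ∑ i ∈ S, (F i).coeff k :=
  map_sum (HahnSeries.coeff.addMonoidHom k) F S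

theorem coeff_mul_eq_finsum (F X : LaurentSeries ℂ) (k : ℤ) :
    (F * X).coeff k = ∑ᶠ s : ℤ, F.coeff (k - s) * X.coeff s := by
  classical
  rw [HahnSeries.coeff_mul]
  symm
  have hinj : Set.InjOn Prod.snd
      (Finset.antidiagonal F.isPWO_support X.isPWO_support k : Set (ℤ × ℤ)) := by
    rintro ⟨a, b⟩ hab ⟨c, d⟩ hcd h
    simp only [Finset.mem_coe, Finset.mem_antidiagonal] at hab hcd h
    ext
    · simp only; omega
    · exact h
  rw [finsum_eq_sum_of_support_subset
    (s := (Finset.antidiagonal F.isPWO_support X.isPWO_support k).image Prod.snd)]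
  · rw [Finset.sum_image hinj]
    refine Finset.sum_congr rfl ?_
    rintro ⟨a, b⟩ hab
    simp only [Finset.mem_antidiagonal] at hab
    simp only [← hab.2.2, add_sub_cancel_right]
  · intro s hs
    simp only [Function.mem_support, ne_eq, mul_eq_zero, not_or] at hs
    simp only [Finset.coe_image, Set.mem_image, Finset.mem_coe, Finset.mem_antidiagonal]
    exact ⟨(k - s, s), ⟨hs.1, hs.2, by simp⟩, rfl⟩

theorem coeff_mul_eq_zero {F X : LaurentSeries ℂ} {a b : ℤ} (hF : ∀ k < a, F.coeff k = 0)
    (hX : ∀ k < b, X.coeff k = 0) (k : ℤ) (hk : k < a + b) : (F * X).coeff k = 0 := by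
  rw [coeff_mul_eq_finsum]
  refine (finsum_congr fun s => ?_).trans finsum_zero
  by_cases hs : s < b
  · rw [hX s hs, mul_zero]
  · rw [hF _ (by omega), zero_mul]

theorem exists_coeff_lt_eq_zero (X : LaurentSeries ℂ) : ∃ N : ℤ, ∀ k < N, X.coeff k = 0 :=
  ⟨X.order, fun _ => HahnSeries.coeff_eq_zero_of_lt_order⟩

theorem coeff_expL_sub_one_lt (k : ℤ) (hk : k < 1) : (expL - 1).coeff k = 0 := by
  rw [HahnSeries.coeff_sub, expL, coeff_ofPowerSeries_int, HahnSeries.coeff_one]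
  rcases lt_or_eq_of_le (show k ≤ 0 by omega) with h | rfl
  · simp [h.ne, h.not_ge]
  · simp

theorem coeff_expL_sub_one_pow (M : ℕ) (k : ℤ) (hk : k < M) :
    ((expL - 1) ^ M).coeff k = 0 := by
  induction M generalizing k with
  | zero => simp at hk; simp [hk.ne]
  | succ M ih =>
    rw [pow_succ]
    exact coeff_mul_eq_zero ih coeff_expL_sub_one_lt k (by push_cast at hk; omega)

theorem expL_sub_one_ne_zero : expL - 1 ≠ 0 := by
  intro h
  have := congrArg (fun X => X.coeff 1) h
  simp [expL, coeff_ofPowerSeries_int, HahnSeries.coeff_one, PowerSeries.coeff_exp] at this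

theorem hasSubst_exp_sub_one : PowerSeries.HasSubst (PowerSeries.exp ℂ - 1) :=
  PowerSeries.HasSubst.of_constantCoeff_zero' (by simp)

/-- The substitution `t ↦ e^z - 1` from power series to Laurent series. -/
def expSubstPS : PowerSeries ℂ →+* LaurentSeries ℂ :=
  (ofPowerSeries ℤ ℂ).comp (PowerSeries.substAlgHom (R := ℂ) hasSubst_exp_sub_one).toRingHom

theorem expSubstPS_X : expSubstPS PowerSeries.X = expL - 1 := by
  simp [expSubstPS, PowerSeries.substAlgHom_X, expL]

theorem expSubstPS_C (c : ℂ) : expSubstPS (PowerSeries.C c) = HahnSeries.C c := by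
  have := (PowerSeries.substAlgHom (R := ℂ) hasSubst_exp_sub_one).commutes c
  rw [expSubstPS, RingHom.comp_apply]
  erw [this]
  exact HahnSeries.ofPowerSeries_C c

theorem isUnit_expSubstPS (y : Submonoid.powers (PowerSeries.X : PowerSeries ℂ)) :
    IsUnit (expSubstPS y) := by
  obtain ⟨_, n, rfl⟩ := y
  simp only [map_pow, expSubstPS_X]
  exact (isUnit_iff_ne_zero.mpr expL_sub_one_ne_zero).pow n

/-- The substitution `t ↦ e^z - 1` on Laurent series. -/
def expSubst : LaurentSeries ℂ →+* LaurentSeries ℂ :=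
  IsLocalization.lift (M := Submonoid.powers (PowerSeries.X : PowerSeries ℂ)) isUnit_expSubstPS

theorem expSubst_ofPowerSeries (P : PowerSeries ℂ) :
    expSubst (ofPowerSeries ℤ ℂ P) = expSubstPS P :=
  IsLocalization.lift_eq isUnit_expSubstPS P

theorem expSubst_single_one : expSubst (single 1 1) = expL - 1 := by
  rw [← ofPowerSeries_X, expSubst_ofPowerSeries, expSubstPS_X]

theorem expSubst_onePlusT : expSubst onePlusT = expL := by
  rw [onePlusT, map_add, map_one, expSubst_single_one, add_sub_cancel]

theorem expSubst_C (c : ℂ) : expSubst (HahnSeries.C c) = HahnSeries.C c := by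
  rw [← ofPowerSeries_C, expSubst_ofPowerSeries, expSubstPS_C, ofPowerSeries_C]

theorem coeff_C_mul (c : ℂ) (X : LaurentSeries ℂ) (k : ℤ) :
    (HahnSeries.C c * X).coeff k = c * X.coeff k := by
  rw [HahnSeries.C_mul_eq_smul, HahnSeries.coeff_smul, smul_eq_mul]

theorem expSubst_injective : Function.Injective expSubst := RingHom.injective _

theorem eq_single_mul_ofPowerSeries {X : LaurentSeries ℂ} {M : ℤ}
    (hX : ∀ k < M, X.coeff k = 0) :
    X = (single (1 : ℤ) (1 : ℂ)) ^ M *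
      ofPowerSeries ℤ ℂ (PowerSeries.mk fun i => X.coeff (M + i)) := by
  ext k
  rw [← RatFunc.single_zpow, HahnSeries.coeff_single_mul, one_mul, coeff_ofPowerSeries_int]
  split_ifs with h
  · rw [PowerSeries.coeff_mk]
    congr 1
    omega
  · exact hX k (by omega)

theorem coeff_mul_expSubst (G X : LaurentSeries ℂ) (k : ℤ) :
    (G * expSubst X).coeff k = ∑ᶠ n : ℤ, (G * (expL - 1) ^ n).coeff k * X.coeff n := by
  obtain ⟨g, hg⟩ := exists_coeff_lt_eq_zero G
  obtain ⟨n₀, hn₀⟩ := exists_coeff_lt_eq_zero X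
  obtain ⟨M, hM⟩ : ∃ M : ℕ, k < g + M := ⟨(k - g + 1).toNat, by omega⟩
  have hvan : ∀ n : ℤ, (M : ℤ) ≤ n → (G * (expL - 1) ^ n).coeff k = 0 := by
    intro n hn
    lift n to ℕ using by omega
    rw [zpow_natCast]
    exact coeff_mul_eq_zero hg (coeff_expL_sub_one_pow n) k (by omega)
  set S := Finset.Ico n₀ (M : ℤ)
  set R := X - ∑ n ∈ S, HahnSeries.C (X.coeff n) * (single (1 : ℤ) (1 : ℂ)) ^ n with hR
  have hRc : ∀ j < (M : ℤ), R.coeff j = 0 := by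
    intro j hj
    rw [hR, HahnSeries.coeff_sub, coeff_finset_sum]
    simp only [coeff_C_mul, ← RatFunc.single_zpow, HahnSeries.coeff_single,
      mul_ite, mul_one, mul_zero, Finset.sum_ite_eq]
    split_ifs with h
    · simp
    · rw [hn₀ j (by simp only [S, Finset.mem_Ico] at h; omega), sub_zero]
  have hX : X = ∑ n ∈ S, HahnSeries.C (X.coeff n) * (single (1 : ℤ) (1 : ℂ)) ^ n + R := by
    rw [hR]; ring
  have hRk : (G * expSubst R).coeff k = 0 := by
    rw [eq_single_mul_ofPowerSeries hRc, map_mul, map_zpow₀, expSubst_single_one, zpow_natCast,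
      ← mul_assoc, expSubst_ofPowerSeries]
    refine coeff_mul_eq_zero (a := g + M) (b := 0)
      (coeff_mul_eq_zero hg (coeff_expL_sub_one_pow M)) (fun j hj => ?_) k (by omega)
    rw [expSubstPS, RingHom.comp_apply, coeff_ofPowerSeries_int, if_neg (by omega)]
  rw [finsum_eq_sum_of_support_subset (s := S)]
  · conv_lhs => rw [hX]
    rw [map_add, mul_add, HahnSeries.coeff_add, hRk, add_zero, map_sum, Finset.mul_sum,
      coeff_finset_sum]
    refine Finset.sum_congr rfl fun n _ => ?_
    rw [map_mul, expSubst_C, map_zpow₀, expSubst_single_one, mul_left_comm, coeff_C_mul, mul_comm]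
  · intro n hn
    simp only [Function.mem_support, ne_eq, mul_eq_zero, not_or] at hn
    simp only [S, Finset.coe_Ico, Set.mem_Ico]
    constructor
    · by_contra h
      exact hn.2 (hn₀ n (by omega))
    · by_contra h
      exact hn.1 (hvan n (by omega))

theorem expSubst_eval₂ (f : Polynomial ℂ) (U : LaurentSeries ℂ) :
    expSubst (f.eval₂ HahnSeries.C U) = f.eval₂ HahnSeries.C (expSubst U) := by
  rw [Polynomial.hom_eval₂]
  congr 1
  ext1 c
  exact expSubst_C c

theorem coeff_onePlusT_pow_mul (X : LaurentSeries ℂ) (i : ℕ) (k : ℤ) :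
    (onePlusT ^ i * X).coeff k
      = ∑ s ∈ Finset.range (i + 1), (i.choose s : ℂ) * X.coeff (k - s) := by
  rw [onePlusT, add_comm, add_pow, Finset.sum_mul, coeff_finset_sum]
  refine Finset.sum_congr rfl fun s _ => ?_
  rw [one_pow, mul_one, mul_right_comm, ← RatFunc.single_one_eq_pow, mul_comm,
    ← map_natCast (HahnSeries.C : ℂ →+* LaurentSeries ℂ), coeff_C_mul,
    HahnSeries.coeff_single_mul, one_mul]

theorem coeff_eval₂_mul (f : Polynomial ℂ) (U X : LaurentSeries ℂ) (k : ℤ) :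
    (f.eval₂ HahnSeries.C U * X).coeff k = ∑ i ∈ f.support, f.coeff i * (U ^ i * X).coeff k := by
  rw [Polynomial.eval₂_eq_sum, Polynomial.sum_def, Finset.sum_mul, coeff_finset_sum]
  refine Finset.sum_congr rfl fun s _ => ?_
  rw [mul_assoc, coeff_C_mul]

theorem coeff_finsum_C_mul_zpow (U : LaurentSeries ℂ) {p : ℤ → ℂ} (hp : p.support.Finite) (k : ℤ) :
    (∑ᶠ m, HahnSeries.C (p m) * U ^ m).coeff k = ∑ᶠ m, (U ^ m).coeff k * p m := by
  have h : (Function.support fun m => HahnSeries.C (p m) * U ^ m).Finite :=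
    hp.subset fun m hm hpm => hm (by simp [hpm])
  refine ((HahnSeries.coeff.addMonoidHom k).map_finsum h).trans (finsum_congr fun m => ?_)
  exact (coeff_C_mul _ _ _).trans (mul_comm _ _)

theorem coeff_eval₂_expL_mul (f : Polynomial ℂ) (Y : LaurentSeries ℂ) (r : ℤ) :
    (f.eval₂ HahnSeries.C expL * Y).coeff r
      = ∑ᶠ j : ℤ, (∑ i ∈ f.support, f.coeff i * expC i (r + j + 1)) * Y.coeff (-j - 1) := by
  rw [coeff_mul_eq_finsum,
    ← finsum_comp_equiv ((Equiv.neg ℤ).trans (Equiv.subRight (1 : ℤ)))]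
  refine finsum_congr fun j => ?_
  simp only [Equiv.trans_apply, Equiv.neg_apply, Equiv.subRight_apply]
  congr 1
  rw [← mul_one (f.eval₂ HahnSeries.C expL), coeff_eval₂_mul]
  refine Finset.sum_congr rfl fun i _ => ?_
  rw [mul_one, ← zpow_natCast, coeff_expL_zpow, expC_eq_subC]
  congr 2
  ring

theorem expSubst_finsum_C_mul_zpow {p : ℤ → ℂ} (hp : p.support.Finite) :
    expSubst (∑ᶠ m, HahnSeries.C (p m) * onePlusT ^ m) = ∑ᶠ m, HahnSeries.C (p m) * expL ^ m := by
  have h : (Function.support fun m => HahnSeries.C (p m) * onePlusT ^ m).Finite :=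
    hp.subset fun m hm hpm => hm (by simp [hpm])
  refine (expSubst.toAddMonoidHom.map_finsum h).trans (finsum_congr fun m => ?_)
  change expSubst (HahnSeries.C (p m) * onePlusT ^ m) = _
  rw [map_mul, map_zpow₀, expSubst_C, expSubst_onePlusT]

theorem mul_finsum_C_mul_zpow {U : LaurentSeries ℂ} (hU : U ≠ 0) (a : ℤ) {p : ℤ → ℂ}
    (hp : p.support.Finite) :
    U ^ a * ∑ᶠ m, HahnSeries.C (p m) * U ^ m = ∑ᶠ m, HahnSeries.C (p (m - a)) * U ^ m := by
  have h : (Function.support fun m => HahnSeries.C (p m) * U ^ m).Finite :=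
    hp.subset fun m hm hpm => hm (by simp [hpm])
  rw [mul_finsum' _ _ h, ← finsum_comp_equiv (Equiv.addRight a)
    (f := fun m => HahnSeries.C (p (m - a)) * U ^ m)]
  refine finsum_congr fun m => ?_
  simp only [Equiv.coe_addRight, add_sub_cancel_right, zpow_add₀ hU]
  ring

theorem eval₂_mul_finsum_C_mul_zpow {U : LaurentSeries ℂ} (hU : U ≠ 0) (g : Polynomial ℂ)
    {p : ℤ → ℂ} (hp : p.support.Finite) :
    g.eval₂ HahnSeries.C U * ∑ᶠ m, HahnSeries.C (p m) * U ^ m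
      = ∑ᶠ m, HahnSeries.C (g.sum fun i c => c * p (m - i)) * U ^ m := by
  have h : ∀ i : ℕ, (Function.support fun m : ℤ =>
      HahnSeries.C (g.coeff i * p (m - i)) * U ^ m).Finite :=
    fun i => (hp.preimage (sub_left_injective (b := (i : ℤ))).injOn).subset
      fun m hm hpm => hm (by
        have hpm : p (m - i) = 0 := hpm
        simp [hpm])
  rw [Polynomial.eval₂_eq_sum, Polynomial.sum_def, Finset.sum_mul]
  simp_rw [Polynomial.sum_def, map_sum, Finset.sum_mul]
  rw [finsum_sum_comm _ _ fun i _ => h i]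
  refine Finset.sum_congr rfl fun i _ => ?_
  rw [mul_assoc, ← zpow_natCast, mul_finsum_C_mul_zpow hU _ hp, mul_finsum]
  exact finsum_congr fun m => by rw [map_mul, mul_assoc]

/-- The associativity relation for `z₁ = z₂ + z₀` in terms of Laurent series. -/
theorem shift_assoc_iff (f : Polynomial ℂ) (X : LaurentSeries ℂ) {p : ℤ → ℂ}
    (hp : p.support.Finite) :
    (∀ k : ℤ, ∑ i ∈ f.support, f.coeff i *
        ∑ s ∈ Finset.range (i + 1), (i.choose s : ℂ) * X.coeff (k - s)
      = if 0 ≤ k then ∑ᶠ m, intChoose m k.toNat * p m else 0) ↔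
    f.eval₂ HahnSeries.C onePlusT * X = ∑ᶠ m, HahnSeries.C (p m) * onePlusT ^ m := by
  rw [HahnSeries.ext_iff, funext_iff]
  refine forall_congr' fun k => ?_
  rw [coeff_eval₂_mul, coeff_finsum_C_mul_zpow _ hp]
  simp_rw [coeff_onePlusT_pow_mul, coeff_onePlusT_zpow]
  split_ifs <;> simp

/-- The associativity relation for `z₁ = z₂ e^{z₀}` in terms of Laurent series. -/
theorem exp_assoc_iff (f : Polynomial ℂ) (Y : LaurentSeries ℂ) {p : ℤ → ℂ}
    (hp : p.support.Finite) :
    (∀ r : ℤ, ∑ᶠ j : ℤ, (∑ i ∈ f.support, f.coeff i * expC i (r + j + 1)) * Y.coeff (-j - 1)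
      = ∑ᶠ m, subC m r * p m) ↔
    f.eval₂ HahnSeries.C expL * Y = ∑ᶠ m, HahnSeries.C (p m) * expL ^ m := by
  rw [HahnSeries.ext_iff, funext_iff]
  refine forall_congr' fun k => ?_
  rw [coeff_eval₂_expL_mul, coeff_finsum_C_mul_zpow _ hp]
  simp_rw [coeff_expL_zpow]

theorem onePlusT_assoc_iff_expL_assoc (f : Polynomial ℂ) {X Y : LaurentSeries ℂ} {p : ℤ → ℂ}
    (hp : p.support.Finite) (a : ℤ)
    (hY : ∀ k, Y.coeff k = ∑ᶠ m, tcoef a m k * X.coeff (-m - 1)) :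
    f.eval₂ HahnSeries.C onePlusT * X = ∑ᶠ m, HahnSeries.C (p m) * onePlusT ^ m ↔
    f.eval₂ HahnSeries.C expL * Y = ∑ᶠ m, HahnSeries.C (p (m - a)) * expL ^ m := by
  have hYX : Y = expL ^ a * expSubst X := by
    ext k
    rw [hY, coeff_mul_expSubst, ← finsum_comp_equiv ((Equiv.neg ℤ).trans (Equiv.subRight (1 : ℤ)))]
    refine finsum_congr fun m => ?_
    simp [tcoef_eq]
  rw [← mul_finsum_C_mul_zpow expL_ne_zero a hp, hYX, mul_left_comm,
    mul_right_inj' (zpow_ne_zero a expL_ne_zero), ← expSubst_onePlusT, ← expSubst_eval₂, ← map_mul,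
    expSubst_onePlusT, ← expSubst_finsum_C_mul_zpow hp, expSubst_injective.eq_iff]

end LaurentSeriesSubstitution

section VectorValued

variable {W : Type*} [AddCommGroup W] [Module ℂ W]

theorem tcoef_eq_zero {h m k : ℤ} (hk : m < -k - 1) (hm : m < 0) : tcoef h m k = 0 := by
  rw [tcoef_eq]
  obtain ⟨n, hn⟩ : ∃ n : ℕ, -m - 1 = n := ⟨(-m - 1).toNat, by omega⟩
  rw [hn, zpow_natCast]
  refine coeff_mul_eq_zero (a := 0) (fun j hj => ?_) (coeff_expL_sub_one_pow n) k (by omega)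
  rw [coeff_expL_zpow, subC, if_neg (by omega)]

theorem finite_support_tcoef_smul {M : Type*} [AddCommGroup M] [Module ℂ M] {X : ℤ → M}
    (hX : ∃ J : ℤ, ∀ j, J ≤ j → X j = 0) (h k : ℤ) :
    (Function.support fun m => tcoef h m k • X m).Finite := by
  obtain ⟨J, hJ⟩ := hX
  refine (Set.finite_Icc (min (-k - 1) 0) J).subset fun m hm => ⟨?_, ?_⟩
  · by_contra hlt
    exact hm (by simp only [tcoef_eq_zero (h := h) (k := k) (m := m) (by omega) (by omega),
      zero_smul])
  · by_contra hlt
    exact hm (by simp only [hJ m (by omega), smul_zero])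

theorem expC_of_neg (i : ℕ) {s : ℤ} (hs : s < 0) : expC i s = 0 := by
  rw [expC, if_neg (by omega)]

theorem finite_support_expC_smul {Y : ℤ → W} (hY : ∃ J : ℤ, ∀ j, J ≤ j → Y j = 0)
    (f : Polynomial ℂ) (r : ℤ) :
    (Function.support fun j : ℤ =>
      (∑ i ∈ f.support, f.coeff i * expC i (r + j + 1)) • Y j).Finite := by
  obtain ⟨J, hJ⟩ := hY
  refine (Set.finite_Icc (-r - 1) J).subset fun j hj => ⟨?_, ?_⟩
  · by_contra hlt
    refine hj ?_
    simp only [expC_of_neg _ (show r + j + 1 < 0 by omega), mul_zero, Finset.sum_const_zero,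
      zero_smul]
  · by_contra hlt
    exact hj (by simp only [hJ j (by omega), smul_zero])

theorem finite_support_smul {p : ℤ → W} (hp : p.support.Finite) (c : ℤ → ℂ) :
    (Function.support fun m => c m • p m).Finite :=
  hp.subset fun m hm hpm => hm (by simp only [hpm, smul_zero])

theorem eq_iff_forall_dual_eq {x y : W} : x = y ↔ ∀ l : Module.Dual ℂ W, l x = l y := by
  refine ⟨fun h l => by rw [h], fun h => ?_⟩
  rw [← sub_eq_zero, ← Module.forall_dual_apply_eq_zero_iff ℂ]
  intro l
  rw [map_sub, h, sub_self]

/-- The Laurent series `∑ⱼ l(Xⱼ) t^{-j-1}` for an upper truncated sequence of vectors `X` and a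
linear functional `l`. -/
def dualSeries {X : ℤ → W} (hX : ∃ J : ℤ, ∀ j, J ≤ j → X j = 0) (l : Module.Dual ℂ W) :
    LaurentSeries ℂ :=
  HahnSeries.ofSuppBddBelow (fun k => l (X (-k - 1))) <| by
    obtain ⟨J, hJ⟩ := hX
    refine ⟨-J - 1, fun k hk => ?_⟩
    by_contra hlt
    exact hk (by simp only [hJ (-k - 1) (by omega), map_zero])

theorem coeff_dualSeries {X : ℤ → W} (hX : ∃ J : ℤ, ∀ j, J ≤ j → X j = 0)
    (l : Module.Dual ℂ W) (k : ℤ) : (dualSeries hX l).coeff k = l (X (-k - 1)) := rfl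

theorem finite_support_dual {p : ℤ → W} (hp : p.support.Finite) (l : Module.Dual ℂ W) :
    (Function.support fun m => l (p m)).Finite :=
  hp.subset fun m hm hpm => hm (by simp only [hpm, map_zero])

theorem dual_finsum_smul (l : Module.Dual ℂ W) {p : ℤ → W} {c : ℤ → ℂ}
    (h : (Function.support fun m => c m • p m).Finite) :
    l (∑ᶠ m, c m • p m) = ∑ᶠ m, c m * l (p m) := by
  refine (l.toAddMonoidHom.map_finsum h).trans (finsum_congr fun m => ?_)
  exact l.map_smul _ _

theorem shift_assoc_iff_dual (f : Polynomial ℂ) {X : ℤ → W}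
    (hX : ∃ J : ℤ, ∀ j, J ≤ j → X j = 0) {p : ℤ → W} (hp : p.support.Finite) :
    (∀ k : ℤ, ∑ i ∈ f.support, f.coeff i •
        ∑ s ∈ Finset.range (i + 1), (i.choose s : ℂ) • X (s - k - 1)
      = if 0 ≤ k then ∑ᶠ m, intChoose m k.toNat • p m else 0) ↔
    ∀ l : Module.Dual ℂ W, f.eval₂ HahnSeries.C onePlusT * dualSeries hX l
      = ∑ᶠ m, HahnSeries.C (l (p m)) * onePlusT ^ m := by
  simp_rw [← shift_assoc_iff f (dualSeries hX _) (finite_support_dual hp _)]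
  rw [forall_comm]
  refine forall_congr' fun k => eq_iff_forall_dual_eq.trans (forall_congr' fun l => ?_)
  rw [apply_ite l, dual_finsum_smul l (finite_support_smul hp _), map_zero, map_sum]
  simp_rw [map_smul, map_sum, map_smul, coeff_dualSeries, smul_eq_mul]
  have hidx : ∀ s : ℕ, -(k - (s : ℤ)) - 1 = s - k - 1 := fun s => by ring
  simp_rw [hidx]

theorem exp_assoc_iff_dual (f : Polynomial ℂ) {Y : ℤ → W}
    (hY : ∃ J : ℤ, ∀ j, J ≤ j → Y j = 0) {p : ℤ → W} (hp : p.support.Finite) :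
    (∀ r : ℤ, ∑ᶠ j : ℤ, (∑ i ∈ f.support, f.coeff i * expC i (r + j + 1)) • Y j
      = ∑ᶠ m, subC m r • p m) ↔
    ∀ l : Module.Dual ℂ W, f.eval₂ HahnSeries.C expL * dualSeries hY l
      = ∑ᶠ m, HahnSeries.C (l (p m)) * expL ^ m := by
  simp_rw [← exp_assoc_iff f (dualSeries hY _) (finite_support_dual hp _)]
  rw [forall_comm]
  refine forall_congr' fun k => eq_iff_forall_dual_eq.trans (forall_congr' fun l => ?_)
  rw [dual_finsum_smul l (finite_support_smul hp _),
    dual_finsum_smul l (finite_support_expC_smul hY f k)]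
  simp_rw [coeff_dualSeries]
  have hidx : ∀ j : ℤ, -(-j - 1) - 1 = j := fun s => by ring
  simp_rw [hidx]

/-- The associativity relations for `z₁ = z₂ + z₀` and `z₁ = z₂ e^{z₀}` correspond to each other
under the change of variable `z₀ ↦ z₂ (e^{z₀} - 1)`. -/
theorem shift_assoc_iff_exp_assoc (f : Polynomial ℂ) {X Y : ℤ → W}
    (hX : ∃ J : ℤ, ∀ j, J ≤ j → X j = 0) (hY : ∃ J : ℤ, ∀ j, J ≤ j → Y j = 0) {p : ℤ → W}
    (hp : p.support.Finite) (a : ℤ) (hYX : ∀ k, Y (-k - 1) = ∑ᶠ m, tcoef a m k • X m) :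
    (∀ k : ℤ, ∑ i ∈ f.support, f.coeff i •
        ∑ s ∈ Finset.range (i + 1), (i.choose s : ℂ) • X (s - k - 1)
      = if 0 ≤ k then ∑ᶠ m, intChoose m k.toNat • p m else 0) ↔
    (∀ r : ℤ, ∑ᶠ j : ℤ, (∑ i ∈ f.support, f.coeff i * expC i (r + j + 1)) • Y j
      = ∑ᶠ m, subC m r • p (m - a)) := by
  have hp' : (Function.support fun m => p (m - a)).Finite :=
    hp.preimage (sub_left_injective (b := a)).injOn
  rw [shift_assoc_iff_dual f hX hp, exp_assoc_iff_dual f hY hp']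
  refine forall_congr' fun l => onePlusT_assoc_iff_expL_assoc f (finite_support_dual hp l) a ?_
  intro k
  rw [coeff_dualSeries, hYX, dual_finsum_smul l (finite_support_tcoef_smul hX a k)]
  refine finsum_congr fun m => ?_
  rw [coeff_dualSeries]
  congr 3
  ring

theorem exp_assoc_mul {f : Polynomial ℂ} (g : Polynomial ℂ) {Y : ℤ → W}
    (hY : ∃ J : ℤ, ∀ j, J ≤ j → Y j = 0) {p q : ℤ → W} (hp : p.support.Finite)
    (hq : q.support.Finite) (hqp : ∀ m, q m = g.sum fun i c => c • p (m - i))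
    (h : ∀ r : ℤ, ∑ᶠ j : ℤ, (∑ i ∈ f.support, f.coeff i * expC i (r + j + 1)) • Y j
      = ∑ᶠ m, subC m r • p m) (r : ℤ) :
    ∑ᶠ j : ℤ, (∑ i ∈ (f * g).support, (f * g).coeff i * expC i (r + j + 1)) • Y j
      = ∑ᶠ m, subC m r • q m := by
  rw [exp_assoc_iff_dual f hY hp] at h
  revert r
  rw [exp_assoc_iff_dual (f * g) hY hq]
  intro l
  rw [Polynomial.eval₂_mul, mul_comm (f.eval₂ _ _), mul_assoc, h,
    eval₂_mul_finsum_C_mul_zpow expL_ne_zero g (finite_support_dual hp l)]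
  refine finsum_congr fun m => ?_
  rw [hqp, Polynomial.sum_def, Polynomial.sum_def, map_sum l]
  simp_rw [map_smul, smul_eq_mul]

end VectorValued

section ProductCoefficients

variable {W : Type} [AddCommGroup W] [Module ℂ W] (A B : ℤ → Module.End ℂ W)

theorem pCoeff2_eq_sum (f : Polynomial ℂ) (m k : ℤ) :
    pCoeff2 A B f m k = f.sum fun i c => c • (A (m - i) * B (k + i)) := rfl

theorem pCoeff2_add_poly (f g : Polynomial ℂ) (m k : ℤ) :
    pCoeff2 A B (f + g) m k = pCoeff2 A B f m k + pCoeff2 A B g m k := by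
  simp only [pCoeff2_eq_sum]
  exact Polynomial.sum_add_index f g _ (fun _ => zero_smul _ _) fun _ _ _ => add_smul _ _ _

theorem pCoeff2_monomial (i : ℕ) (c : ℂ) (m k : ℤ) :
    pCoeff2 A B (Polynomial.monomial i c) m k = c • (A (m - i) * B (k + i)) := by
  exact Polynomial.sum_monomial_index c (fun i c => c • (A (m - i) * B (k + i))) (zero_smul _ _)

theorem pCoeff2_mul (f g : Polynomial ℂ) (m k : ℤ) :
    pCoeff2 A B (f * g) m k = g.sum fun i c => c • pCoeff2 A B f (m - i) (k + i) := by
  induction g using Polynomial.induction_on' with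
  | add g h hg hh =>
    rw [mul_add, pCoeff2_add_poly, hg, hh]
    exact (Polynomial.sum_add_index g h
      (fun i c => c • pCoeff2 A B f (m - i) (k + i)) (fun _ => zero_smul _ _)
      fun _ _ _ => add_smul _ _ _).symm
  | monomial j d =>
    rw [Polynomial.sum_monomial_index d (fun i c => c • pCoeff2 A B f (m - i) (k + i))
      (zero_smul _ _)]
    induction f using Polynomial.induction_on' with
    | add g h hg hh => rw [add_mul, pCoeff2_add_poly, pCoeff2_add_poly, hg, hh, smul_add]
    | monomial i c =>
      rw [Polynomial.monomial_mul_monomial, pCoeff2_monomial, pCoeff2_monomial, smul_smul,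
        mul_comm c d]
      have h₁ : m - ((i + j : ℕ) : ℤ) = m - j - i := by push_cast; ring
      have h₂ : k + ((i + j : ℕ) : ℤ) = k + j + i := by push_cast; ring
      rw [h₁, h₂]

variable {A B}

theorem pCoeff2_add_left {A₁ A₂ : ℤ → Module.End ℂ W} (hA : ∀ n, A n = A₁ n + A₂ n)
    (f : Polynomial ℂ) (m k : ℤ) :
    pCoeff2 A B f m k = pCoeff2 A₁ B f m k + pCoeff2 A₂ B f m k := by
  simp only [pCoeff2, hA, add_mul, smul_add, Finset.sum_add_distrib]

theorem pCoeff2_add_right {B₁ B₂ : ℤ → Module.End ℂ W} (hB : ∀ n, B n = B₁ n + B₂ n)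
    (f : Polynomial ℂ) (m k : ℤ) :
    pCoeff2 A B f m k = pCoeff2 A B₁ f m k + pCoeff2 A B₂ f m k := by
  simp only [pCoeff2, hB, mul_add, smul_add, Finset.sum_add_distrib]

theorem pCoeff2_shift {A' B' : ℤ → Module.End ℂ W} {a b : ℤ} (hA : ∀ n, A' n = A (n - a))
    (hB : ∀ n, B' n = B (n - b)) (f : Polynomial ℂ) (m k : ℤ) :
    pCoeff2 A' B' f m k = pCoeff2 A B f (m - a) (k - b) := by
  refine Finset.sum_congr rfl fun i _ => ?_
  rw [hA, hB, sub_right_comm, add_sub_right_comm]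

/-- `f(z₁/z₂) A(z₁) B(z₂) ∈ Hom(W, W((z₁, z₂)))` -/
def IsLowerTruncated (A B : ℤ → Module.End ℂ W) (f : Polynomial ℂ) : Prop :=
  ∀ w : W, ∃ N : ℤ, ∀ m k : ℤ, (m < N ∨ k < N) → pCoeff2 A B f m k w = 0

theorem IsLowerTruncated.finite_support {f : Polynomial ℂ} (h : IsLowerTruncated A B f) (c : ℤ)
    (w : W) : (Function.support fun m => pCoeff2 A B f m (c - m) w).Finite := by
  obtain ⟨N, hN⟩ := h w
  refine (Set.finite_Icc N (c - N)).subset fun m hm => ⟨?_, ?_⟩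
  · by_contra hlt
    exact hm (hN _ _ (Or.inl (by omega)))
  · by_contra hlt
    exact hm (hN _ _ (Or.inr (by omega)))

theorem IsLowerTruncated.mul {f : Polynomial ℂ} (h : IsLowerTruncated A B f)
    (g : Polynomial ℂ) : IsLowerTruncated A B (f * g) := by
  intro w
  obtain ⟨N, hN⟩ := h w
  refine ⟨N - g.natDegree, fun m k hmk => ?_⟩
  rw [pCoeff2_mul, Polynomial.sum_def, LinearMap.sum_apply]
  refine Finset.sum_eq_zero fun i hi => ?_
  have := Polynomial.le_natDegree_of_mem_supp i hi
  rw [LinearMap.smul_apply, hN _ _ (by omega), smul_zero]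

theorem IsLowerTruncated.shift {A' B' : ℤ → Module.End ℂ W} {a b : ℤ}
    (hA : ∀ n, A' n = A (n - a)) (hB : ∀ n, B' n = B (n - b)) {f : Polynomial ℂ}
    (h : IsLowerTruncated A B f) : IsLowerTruncated A' B' f := by
  intro w
  obtain ⟨N, hN⟩ := h w
  refine ⟨N + min a b, fun m k hmk => ?_⟩
  rw [pCoeff2_shift hA hB]
  exact hN _ _ (by omega)

theorem IsLowerTruncated.add {A₁ A₂ B₁ B₂ : ℤ → Module.End ℂ W} {f : Polynomial ℂ}
    (hAB : ∀ m k, pCoeff2 A B f m k = pCoeff2 A₁ B₁ f m k + pCoeff2 A₂ B₂ f m k)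
    (h₁ : IsLowerTruncated A₁ B₁ f) (h₂ : IsLowerTruncated A₂ B₂ f) :
    IsLowerTruncated A B f := by
  intro w
  obtain ⟨N₁, hN₁⟩ := h₁ w
  obtain ⟨N₂, hN₂⟩ := h₂ w
  refine ⟨min N₁ N₂, fun m k hmk => ?_⟩
  rw [hAB, LinearMap.add_apply, hN₁ _ _ (by omega), hN₂ _ _ (by omega), add_zero]

end ProductCoefficients

section Associativity

variable {V W : Type} [AddCommGroup V] [Module ℂ V] [AddCommGroup W] [Module ℂ W]

/-- The associativity condition of a quasi module for the pair `u, v`, with polynomial `f`. -/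
def QuasiAssoc (VA : VertexAlg V) (A : V → ℤ → Module.End ℂ W) (u v : V) (f : Polynomial ℂ) :
    Prop :=
  IsLowerTruncated (A u) (A v) f ∧
    ∀ (k n : ℤ) (w : W),
      (∑ i ∈ f.support, f.coeff i •
        (∑ s ∈ Finset.range (i + 1), ((i.choose s : ℂ)) •
          A (VA.Y u ((s : ℤ) - k - 1) v) (n + s) w))
      = if 0 ≤ k then
          ∑ᶠ m : ℤ, intChoose m k.toNat • pCoeff2 (A u) (A v) f m (n - m + k) w
        else 0

/-- The associativity condition of a `φ`-coordinated quasi module for the pair `u, v`, with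
polynomial `f`. -/
def PhiAssoc (VA : VertexAlg V) (E : V → ℤ → Module.End ℂ W) (u v : V) (f : Polynomial ℂ) :
    Prop :=
  IsLowerTruncated (E u) (E v) f ∧
    ∀ (r n : ℤ) (w : W),
      (∑ᶠ j : ℤ, (∑ i ∈ f.support, f.coeff i * expC i (r + j + 1)) • E (VA.Y u j v) n w)
        = ∑ᶠ m : ℤ, subC m r • pCoeff2 (E u) (E v) f m (n - m) w

/-- A family of fields `A v = ∑ₙ (A v n) zⁿ` depending linearly on `v`. -/
structure IsLinearFamily (A : V → ℤ → Module.End ℂ W) : Prop where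
  add : ∀ u v n, A (u + v) n = A u n + A v n
  smul : ∀ (c : ℂ) v n, A (c • v) n = c • A v n

namespace IsLinearFamily

variable {A : V → ℤ → Module.End ℂ W} (hA : IsLinearFamily A)
include hA

theorem zero (n : ℤ) : A 0 n = 0 := by
  simpa using hA.smul 0 0 n

theorem sum {ι : Type*} (S : Finset ι) (x : ι → V) (n : ℤ) :
    A (∑ i ∈ S, x i) n = ∑ i ∈ S, A (x i) n := by
  classical
  induction S using Finset.induction_on with
  | empty => simp [hA.zero]
  | insert i S hi ih => rw [Finset.sum_insert hi, Finset.sum_insert hi, hA.add, ih]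

theorem finsum {x : ℤ → V} {c : ℤ → ℂ} (h : (Function.support fun m => c m • x m).Finite)
    (n : ℤ) (w : W) : A (∑ᶠ m, c m • x m) n w = ∑ᶠ m, c m • A (x m) n w := by
  let L : V →+ W :=
    { toFun := fun v => A v n w
      map_zero' := by simp [hA.zero]
      map_add' := fun u v => by simp [hA.add] }
  refine (L.map_finsum h).trans (finsum_congr fun m => ?_)
  change A (c m • x m) n w = _
  rw [hA.smul, LinearMap.smul_apply]

theorem eventually_zero (VA : VertexAlg V) (u v : V) (n : ℤ) (w : W) :
    ∃ J : ℤ, ∀ j, J ≤ j → A (VA.Y u j v) n w = 0 := by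
  obtain ⟨J, hJ⟩ := VA.trunc u v
  exact ⟨J, fun j hj => by rw [hJ j hj, hA.zero, LinearMap.zero_apply]⟩

end IsLinearFamily

theorem QuasiAssoc.add {VA : VertexAlg V} {A : V → ℤ → Module.End ℂ W} {u v u₁ v₁ u₂ v₂ : V}
    {f : Polynomial ℂ}
    (hp : ∀ m k, pCoeff2 (A u) (A v) f m k
      = pCoeff2 (A u₁) (A v₁) f m k + pCoeff2 (A u₂) (A v₂) f m k)
    (hY : ∀ j n, A (VA.Y u j v) n = A (VA.Y u₁ j v₁) n + A (VA.Y u₂ j v₂) n)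
    (h₁ : QuasiAssoc VA A u₁ v₁ f) (h₂ : QuasiAssoc VA A u₂ v₂ f) : QuasiAssoc VA A u v f := by
  refine ⟨h₁.1.add hp h₂.1, fun k n w => ?_⟩
  have e₁ := h₁.2 k n w
  have e₂ := h₂.2 k n w
  simp only [hY, hp, LinearMap.add_apply, smul_add, Finset.sum_add_distrib]
  rw [e₁, e₂]
  split_ifs
  · have hidx : ∀ m, n - m + k = n + k - m := fun m => by ring
    simp only [hidx]
    rw [finsum_add_distrib (finite_support_smul (h₁.1.finite_support _ w) _)
      (finite_support_smul (h₂.1.finite_support _ w) _)]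
  · rw [add_zero]

theorem PhiAssoc.add {VA : VertexAlg V} {E : V → ℤ → Module.End ℂ W} (hE : IsLinearFamily E)
    {u v u₁ v₁ u₂ v₂ : V} {f : Polynomial ℂ}
    (hp : ∀ m k, pCoeff2 (E u) (E v) f m k
      = pCoeff2 (E u₁) (E v₁) f m k + pCoeff2 (E u₂) (E v₂) f m k)
    (hY : ∀ j n, E (VA.Y u j v) n = E (VA.Y u₁ j v₁) n + E (VA.Y u₂ j v₂) n)
    (h₁ : PhiAssoc VA E u₁ v₁ f) (h₂ : PhiAssoc VA E u₂ v₂ f) : PhiAssoc VA E u v f := by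
  refine ⟨h₁.1.add hp h₂.1, fun r n w => ?_⟩
  have e₁ := h₁.2 r n w
  have e₂ := h₂.2 r n w
  simp only [hY, hp, LinearMap.add_apply, smul_add]
  rw [finsum_add_distrib (finite_support_expC_smul (hE.eventually_zero VA u₁ v₁ n w) f r)
      (finite_support_expC_smul (hE.eventually_zero VA u₂ v₂ n w) f r), e₁, e₂,
    finsum_add_distrib (finite_support_smul (h₁.1.finite_support _ w) _)
      (finite_support_smul (h₂.1.finite_support _ w) _)]

theorem QuasiAssoc.of_eq_zero {VA : VertexAlg V} {A : V → ℤ → Module.End ℂ W} {u v : V}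
    {f : Polynomial ℂ} (hp : ∀ m k, pCoeff2 (A u) (A v) f m k = 0)
    (hY : ∀ j n, A (VA.Y u j v) n = 0) : QuasiAssoc VA A u v f := by
  refine ⟨fun w => ⟨0, fun m k _ => by rw [hp, LinearMap.zero_apply]⟩, fun k n w => ?_⟩
  simp [hp, hY]

theorem PhiAssoc.of_eq_zero {VA : VertexAlg V} {E : V → ℤ → Module.End ℂ W} {u v : V}
    {f : Polynomial ℂ} (hp : ∀ m k, pCoeff2 (E u) (E v) f m k = 0)
    (hY : ∀ j n, E (VA.Y u j v) n = 0) : PhiAssoc VA E u v f := by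
  refine ⟨fun w => ⟨0, fun m k _ => by rw [hp, LinearMap.zero_apply]⟩, fun k n w => ?_⟩
  simp [hp, hY]

theorem PhiAssoc.mul {VA : VertexAlg V} {E : V → ℤ → Module.End ℂ W} (hE : IsLinearFamily E)
    {u v : V} {f : Polynomial ℂ} (h : PhiAssoc VA E u v f) (g : Polynomial ℂ) :
    PhiAssoc VA E u v (f * g) := by
  refine ⟨h.1.mul g, fun r n w => ?_⟩
  refine exp_assoc_mul g (hE.eventually_zero VA u v n w) (h.1.finite_support n w)
    ((h.1.mul g).finite_support n w) (fun m => ?_) (fun r => h.2 r n w) r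
  rw [pCoeff2_mul, Polynomial.sum_def, Polynomial.sum_def, LinearMap.sum_apply]
  refine Finset.sum_congr rfl fun i _ => ?_
  rw [LinearMap.smul_apply, ← sub_add]

/-- For homogeneous vectors the two associativity conditions agree. -/
theorem quasiAssoc_iff_phiAssoc {VA : GradedVA V} {VA' : VertexAlg V}
    (hY' : ∀ (u : V) (h : ℤ), VA.proj h u = u → ∀ (k : ℤ) (v : V),
      VA'.Y u (-k - 1) v = ∑ᶠ m : ℤ, tcoef h m k • VA.Y u m v)
    {A E : V → ℤ → Module.End ℂ W} (hE : IsLinearFamily E)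
    (hAE : ∀ (v : V) (h : ℤ), VA.proj h v = v → ∀ n : ℤ, E v n = A v (n - h))
    {u v : V} {a b : ℤ} (hu : VA.proj a u = u) (hv : VA.proj b v = v) (f : Polynomial ℂ) :
    QuasiAssoc VA.toVertexAlg A u v f ↔ PhiAssoc VA' E u v f := by
  have htrunc : IsLowerTruncated (A u) (A v) f ↔ IsLowerTruncated (E u) (E v) f :=
    ⟨IsLowerTruncated.shift (hAE u a hu) (hAE v b hv),
      IsLowerTruncated.shift (a := -a) (b := -b)
        (fun n => by rw [hAE u a hu, sub_neg_eq_add, add_sub_cancel_right])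
        (fun n => by rw [hAE v b hv, sub_neg_eq_add, add_sub_cancel_right])⟩
  rw [QuasiAssoc, PhiAssoc, ← htrunc]
  refine and_congr_right fun ht => ?_
  have key (N : ℤ) (w : W) := shift_assoc_iff_exp_assoc f
    (hE.eventually_zero VA.toVertexAlg u v N w) (hE.eventually_zero VA' u v N w)
    (ht.finite_support (N - a - b) w) a fun k => by
      rw [hY' u a hu, hE.finsum (finite_support_tcoef_smul (VA.trunc u v) a k)]
  have hA : ∀ k n s : ℤ, A (VA.Y u (s - k - 1) v) (n + s)
      = E (VA.Y u (s - k - 1) v) (n + a + b + k) := by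
    intro k n s
    rw [hAE _ _ (VA.Y_deg a b (s - k - 1) u v hu hv)]
    congr 1
    ring
  constructor
  · intro h r n w
    refine ((key n w).1 (fun k => ?_) r).trans (finsum_congr fun m => ?_)
    · have := h k (n - a - b - k) w
      simp only [hA] at this
      convert this using 6 <;> ring_nf
    · rw [pCoeff2_shift (hAE u a hu) (hAE v b hv)]
      congr 3
      ring
  · intro h k n w
    simp only [hA]
    refine ((key (n + a + b + k) w).2 (fun r => (h r _ w).trans (finsum_congr fun m => ?_)) k).trans
      ?_
    · rw [pCoeff2_shift (hAE u a hu) (hAE v b hv)]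
      congr 3
      ring
    · have hidx : ∀ m, n + a + b + k - a - b - m = n - m + k := fun m => by ring
      simp only [hidx]

end Associativity

section Grading

variable {V W : Type} [AddCommGroup V] [Module ℂ V] [AddCommGroup W] [Module ℂ W]

theorem VertexAlg.Y_zero (VA : VertexAlg V) (n : ℤ) : VA.Y 0 n = 0 := by
  simpa using VA.Y_smul 0 0 n

namespace GradedVA

variable (VA : GradedVA V)

theorem proj_proj (h : ℤ) (v : V) : VA.proj h (VA.proj h v) = VA.proj h v := by
  rw [← Module.End.mul_apply, VA.proj_comp, if_pos rfl]

theorem proj_of_ne {h k : ℤ} {v : V} (hv : VA.proj h v = v) (hk : k ≠ h) : VA.proj k v = 0 := by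
  rw [← hv, ← Module.End.mul_apply, VA.proj_comp, if_neg hk, LinearMap.zero_apply]

theorem exists_sum_proj (v : V) : ∃ S : Finset ℤ, ∑ h ∈ S, VA.proj h v = v :=
  ⟨(VA.proj_finite v).toFinset, by
    rw [← finsum_eq_sum_of_support_subset _ (by simp [Function.support]), VA.proj_sum]⟩

/-- A relation depending on a pair of vectors and a polynomial, which is biadditive and stable
under multiplying the polynomial, is satisfiable for all pairs once it is for homogeneous ones. -/
theorem exists_polynomial_of_homogeneous (R : ℂ → Prop) (P : V → V → Polynomial ℂ → Prop)
    (zero_left : ∀ v f, P 0 v f) (zero_right : ∀ u f, P u 0 f)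
    (add_left : ∀ u₁ u₂ v f, P u₁ v f → P u₂ v f → P (u₁ + u₂) v f)
    (add_right : ∀ u v₁ v₂ f, P u v₁ f → P u v₂ f → P u (v₁ + v₂) f)
    (mul : ∀ u v a b, VA.proj a u = u → VA.proj b v = v → ∀ f g, P u v f → P u v (f * g))
    (homogeneous : ∀ u v a b, VA.proj a u = u → VA.proj b v = v →
      ∃ f : Polynomial ℂ, f ≠ 0 ∧ (∀ c, f.IsRoot c → R c) ∧ P u v f) (u v : V) :
    ∃ f : Polynomial ℂ, f ≠ 0 ∧ (∀ c, f.IsRoot c → R c) ∧ P u v f := by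
  obtain ⟨S, hS⟩ := VA.exists_sum_proj u
  obtain ⟨T, hT⟩ := VA.exists_sum_proj v
  choose F hF0 hFR hFP using fun x : ℤ × ℤ =>
    homogeneous _ _ x.1 x.2 (VA.proj_proj x.1 u) (VA.proj_proj x.2 v)
  refine ⟨∏ x ∈ S ×ˢ T, F x, Finset.prod_ne_zero_iff.mpr fun x _ => hF0 x, fun c hc => ?_, ?_⟩
  · rw [Polynomial.IsRoot.def, Polynomial.eval_prod, Finset.prod_eq_zero_iff] at hc
    obtain ⟨x, _, hx⟩ := hc
    exact hFR x c hx
  · rw [← hS, ← hT]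
    generalize hf : ∏ x ∈ S ×ˢ T, F x = f
    refine Finset.sum_induction _ (fun y => P y _ f) (fun _ _ => add_left _ _ _ f) (zero_left _ f)
      fun a ha => ?_
    refine Finset.sum_induction _ (fun y => P _ y f) (fun _ _ => add_right _ _ _ f)
      (zero_right _ f) fun b hb => ?_
    obtain ⟨g, hg⟩ : F (a, b) ∣ f :=
      hf ▸ Finset.dvd_prod_of_mem F (Finset.mk_mem_product ha hb)
    rw [hg]
    exact mul _ _ a b (VA.proj_proj a u) (VA.proj_proj b v) _ _ (hFP (a, b))

/-- The family of fields `Y(z^{ε L(0)} v, z) = ∑ₙ (A (z^{ε L(0)} v) n) zⁿ`, up to the sign of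
`ε`: on `V_(h)`, coefficients are moved by `ε h`. -/
def degShift (ε : ℤ) (A : V → ℤ → Module.End ℂ W) (v : V) (n : ℤ) : Module.End ℂ W :=
  ∑ᶠ h : ℤ, A (VA.proj h v) (n + ε * h)

variable {VA} {A : V → ℤ → Module.End ℂ W} (hA : IsLinearFamily A) (ε : ℤ)
include hA

theorem degShift_finite (v : V) (n : ℤ) :
    (Function.support fun h => A (VA.proj h v) (n + ε * h)).Finite :=
  (VA.proj_finite v).subset fun h hh hv => hh (by
    simp only [show VA.proj h v = 0 from hv, hA.zero])

theorem isLinearFamily_degShift : IsLinearFamily (VA.degShift ε A) where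
  add u v n := by
    simp only [degShift, map_add, hA.add]
    exact finsum_add_distrib (degShift_finite hA ε u n) (degShift_finite hA ε v n)
  smul c v n := by
    simp only [degShift, map_smul, hA.smul]
    exact (smul_finsum' c (degShift_finite hA ε v n)).symm

theorem degShift_of_proj {v : V} {h : ℤ} (hv : VA.proj h v = v) (n : ℤ) :
    VA.degShift ε A v n = A v (n + ε * h) := by
  rw [degShift, finsum_eq_single _ h fun k hk => by rw [VA.proj_of_ne hv hk, hA.zero], hv]

theorem lower_trunc_degShift (ht : ∀ v w, ∃ N : ℤ, ∀ n, n < N → A v n w = 0) (v : V) (w : W) :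
    ∃ N : ℤ, ∀ n, n < N → VA.degShift ε A v n w = 0 := by
  obtain ⟨S, hS⟩ := VA.exists_sum_proj v
  choose N hN using fun h => ht (VA.proj h v) w
  obtain ⟨B, hB⟩ := ((S.image fun h => N h - ε * h) : Finset ℤ).bddBelow
  refine ⟨B, fun n hn => ?_⟩
  rw [← hS, (isLinearFamily_degShift hA ε).sum, LinearMap.sum_apply]
  refine Finset.sum_eq_zero fun h hh => ?_
  rw [degShift_of_proj hA ε (VA.proj_proj h v)]
  have : B ≤ N h - ε * h := hB (Finset.mem_coe.mpr (Finset.mem_image_of_mem _ hh))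
  exact hN h _ (by linarith)

theorem eq_of_eq_on_homogeneous {A' : V → ℤ → Module.End ℂ W} (hA' : IsLinearFamily A')
    (h : ∀ (v : V) (h : ℤ), VA.proj h v = v → ∀ n, A v n = A' v n) : A = A' := by
  funext v n
  obtain ⟨S, hS⟩ := VA.exists_sum_proj v
  rw [← hS, hA.sum, hA'.sum]
  exact Finset.sum_congr rfl fun k _ => h _ k (VA.proj_proj k v) n

end GradedVA

variable {VA : VertexAlg V} {A : V → ℤ → Module.End ℂ W} (hA : IsLinearFamily A)
include hA

theorem QuasiAssoc.add_left {u₁ u₂ v : V} {f : Polynomial ℂ} (h₁ : QuasiAssoc VA A u₁ v f)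
    (h₂ : QuasiAssoc VA A u₂ v f) : QuasiAssoc VA A (u₁ + u₂) v f :=
  QuasiAssoc.add (pCoeff2_add_left (hA.add u₁ u₂) f)
    (fun j n => by rw [VA.Y_add, LinearMap.add_apply, hA.add]) h₁ h₂

theorem QuasiAssoc.add_right {u v₁ v₂ : V} {f : Polynomial ℂ} (h₁ : QuasiAssoc VA A u v₁ f)
    (h₂ : QuasiAssoc VA A u v₂ f) : QuasiAssoc VA A u (v₁ + v₂) f :=
  QuasiAssoc.add (pCoeff2_add_right (hA.add v₁ v₂) f)
    (fun j n => by rw [map_add, hA.add]) h₁ h₂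

theorem PhiAssoc.add_left {u₁ u₂ v : V} {f : Polynomial ℂ} (h₁ : PhiAssoc VA A u₁ v f)
    (h₂ : PhiAssoc VA A u₂ v f) : PhiAssoc VA A (u₁ + u₂) v f :=
  PhiAssoc.add hA (pCoeff2_add_left (hA.add u₁ u₂) f)
    (fun j n => by rw [VA.Y_add, LinearMap.add_apply, hA.add]) h₁ h₂

theorem PhiAssoc.add_right {u v₁ v₂ : V} {f : Polynomial ℂ} (h₁ : PhiAssoc VA A u v₁ f)
    (h₂ : PhiAssoc VA A u v₂ f) : PhiAssoc VA A u (v₁ + v₂) f :=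
  PhiAssoc.add hA (pCoeff2_add_right (hA.add v₁ v₂) f)
    (fun j n => by rw [map_add, hA.add]) h₁ h₂

theorem pCoeff2_zero_left (v : V) (f : Polynomial ℂ) (m k : ℤ) :
    pCoeff2 (A 0) (A v) f m k = 0 := by
  simp [pCoeff2, hA.zero]

theorem pCoeff2_zero_right (u : V) (f : Polynomial ℂ) (m k : ℤ) :
    pCoeff2 (A u) (A 0) f m k = 0 := by
  simp [pCoeff2, hA.zero]

theorem mode_zero_left (v : V) (j n : ℤ) : A (VA.Y 0 j v) n = 0 := by
  rw [VA.Y_zero, LinearMap.zero_apply, hA.zero]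

theorem mode_zero_right (u : V) (j n : ℤ) : A (VA.Y u j 0) n = 0 := by
  rw [map_zero, hA.zero]

end Grading

section Correspondence

variable {V W : Type} [AddCommGroup V] [Module ℂ V] [AddCommGroup W] [Module ℂ W]
  {G : Type} [Group G] {VA : GradedVA V} {ρ : G →* (V ≃ₗ[ℂ] V)} {χ : G →* ℂˣ} {VA' : VertexAlg V}

theorem QuasiMod.isLinearFamily (M : QuasiMod VA ρ χ W) : IsLinearFamily M.A :=
  ⟨M.A_add, M.A_smul⟩

theorem PhiMod.isLinearFamily (M : PhiMod VA' ρ χ W) : IsLinearFamily M.E :=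
  ⟨M.E_add, M.E_smul⟩

theorem QuasiMod.eq_of_A_eq {M₁ M₂ : QuasiMod VA ρ χ W} (h : M₁.A = M₂.A) : M₁ = M₂ := by
  cases M₁
  cases M₂
  cases h
  rfl

theorem PhiMod.eq_of_E_eq {M₁ M₂ : PhiMod VA' ρ χ W} (h : M₁.E = M₂.E) : M₁ = M₂ := by
  cases M₁
  cases M₂
  cases h
  rfl

/-- The `φ`-coordinated quasi module `Y_W^φ(v, z) = Y_W(z^{L(0)} v, z)` of a quasi module. -/
def QuasiMod.toPhiMod (M : QuasiMod VA ρ χ W)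
    (hρ : ∀ g (h : ℤ) (v : V), ρ g (VA.proj h v) = VA.proj h (ρ g v))
    (hone : VA'.one = VA.one)
    (hY' : ∀ (u : V) (h : ℤ), VA.proj h u = u → ∀ (k : ℤ) (v : V),
      VA'.Y u (-k - 1) v = ∑ᶠ m : ℤ, tcoef h m k • VA.Y u m v) : PhiMod VA' ρ χ W where
  E := VA.degShift (-1) M.A
  E_add := (GradedVA.isLinearFamily_degShift M.isLinearFamily (-1)).add
  E_smul := (GradedVA.isLinearFamily_degShift M.isLinearFamily (-1)).smul
  lower_trunc := GradedVA.lower_trunc_degShift M.isLinearFamily (-1) M.lower_trunc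
  vacuum n := by
    rw [hone, GradedVA.degShift_of_proj M.isLinearFamily (-1) VA.one_deg, mul_zero, add_zero,
      M.vacuum]
  equivar g v n := by
    rw [GradedVA.degShift, GradedVA.degShift,
      smul_finsum' _ (GradedVA.degShift_finite M.isLinearFamily (-1) v n)]
    refine finsum_congr fun h => ?_
    rw [← hρ, M.equivar g _ h _ (VA.proj_proj h v)]
    congr 2
    ring
  assoc := by
    have hE := GradedVA.isLinearFamily_degShift (VA := VA) M.isLinearFamily (-1)
    refine VA.exists_polynomial_of_homogeneous (fun c => ∃ g : G, (χ g : ℂ) = c)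
      (PhiAssoc VA' (VA.degShift (-1) M.A))
      (fun v f => .of_eq_zero (pCoeff2_zero_left hE v f) (mode_zero_left hE v))
      (fun u f => .of_eq_zero (pCoeff2_zero_right hE u f) (mode_zero_right hE u))
      (fun _ _ _ _ => .add_left hE) (fun _ _ _ _ => .add_right hE)
      (fun _ _ _ _ _ _ f g h => h.mul hE g) fun u v a b hu hv => ?_
    obtain ⟨f, hf, hroot, h⟩ := M.assoc u v
    refine ⟨f, hf, hroot, (quasiAssoc_iff_phiAssoc hY' hE (fun v h hv n => ?_) hu hv f).1 h⟩
    rw [GradedVA.degShift_of_proj M.isLinearFamily (-1) hv]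
    congr 1
    ring

/-- The quasi module `Y_W(v, z) = Y_W^φ(z^{-L(0)} v, z)` of a `φ`-coordinated quasi module. -/
def PhiMod.toQuasiMod (M : PhiMod VA' ρ χ W)
    (hρ : ∀ g (h : ℤ) (v : V), ρ g (VA.proj h v) = VA.proj h (ρ g v))
    (hone : VA'.one = VA.one)
    (hY' : ∀ (u : V) (h : ℤ), VA.proj h u = u → ∀ (k : ℤ) (v : V),
      VA'.Y u (-k - 1) v = ∑ᶠ m : ℤ, tcoef h m k • VA.Y u m v) : QuasiMod VA ρ χ W where
  A := VA.degShift 1 M.E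
  A_add := (GradedVA.isLinearFamily_degShift M.isLinearFamily 1).add
  A_smul := (GradedVA.isLinearFamily_degShift M.isLinearFamily 1).smul
  lower_trunc := GradedVA.lower_trunc_degShift M.isLinearFamily 1 M.lower_trunc
  vacuum n := by
    rw [GradedVA.degShift_of_proj M.isLinearFamily 1 VA.one_deg, mul_zero, add_zero, ← hone,
      M.vacuum]
  equivar g v h n hv := by
    have hgv : VA.proj h (ρ g v) = ρ g v := by rw [← hρ, hv]
    rw [GradedVA.degShift_of_proj M.isLinearFamily 1 hv,
      GradedVA.degShift_of_proj M.isLinearFamily 1 hgv, M.equivar, one_mul]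
  assoc := by
    have hA := GradedVA.isLinearFamily_degShift (VA := VA) M.isLinearFamily 1
    have hiff {u v : V} {a b : ℤ} (hu : VA.proj a u = u) (hv : VA.proj b v = v) (f) :
        QuasiAssoc VA.toVertexAlg (VA.degShift 1 M.E) u v f ↔ PhiAssoc VA' M.E u v f :=
      quasiAssoc_iff_phiAssoc hY' M.isLinearFamily (fun v h hv n => by
        rw [GradedVA.degShift_of_proj M.isLinearFamily 1 hv, one_mul, sub_add_cancel]) hu hv f
    refine VA.exists_polynomial_of_homogeneous (fun c => ∃ g : G, (χ g : ℂ) = c)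
      (QuasiAssoc VA.toVertexAlg (VA.degShift 1 M.E))
      (fun v f => .of_eq_zero (pCoeff2_zero_left hA v f) (mode_zero_left hA v))
      (fun u f => .of_eq_zero (pCoeff2_zero_right hA u f) (mode_zero_right hA u))
      (fun _ _ _ _ => .add_left hA) (fun _ _ _ _ => .add_right hA)
      (fun _ _ _ _ hu hv f g h => (hiff hu hv _).2 (((hiff hu hv f).1 h).mul M.isLinearFamily g))
      fun u v a b hu hv => ?_
    obtain ⟨f, hf, hroot, h⟩ := M.assoc u v
    exact ⟨f, hf, hroot, (hiff hu hv f).2 h⟩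

end Correspondence

/-- Let `V` be a `ℤ`-graded vertex algebra, `G` a group of
grading-preserving automorphisms and `χ` a character of `G`.  Let `(V, Y[·,z], 𝟏)` be the
vertex algebra with `Y[v,z] = Y(e^{zL(0)}v, e^z - 1)` (described by the coefficients
`tcoef`).  Then `(G,χ)`-equivariant quasi `V`-modules `(W, Y_W)` are exactly the
`(G,χ)`-equivariant `φ`-coordinated quasi modules `(W, Y_W^φ)` for `(V, Y[·,z], 𝟏)`, with
`Y_W^φ(v,z) = Y_W(z^{L(0)} v, z)`. -/
theorem statement_5 {V W : Type} [AddCommGroup V] [Module ℂ V]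
    [AddCommGroup W] [Module ℂ W] {G : Type} [Group G]
    (VA : GradedVA V) (ρ : G →* (V ≃ₗ[ℂ] V))
    (hρ : ∀ g, VA.toVertexAlg.IsAuto (ρ g) ∧ ∀ (h : ℤ) (v : V),
      ρ g (VA.proj h v) = VA.proj h (ρ g v))
    (χ : G →* ℂˣ)
    (VA' : VertexAlg V) (hone : VA'.one = VA.one)
    (hY' : ∀ (u : V) (h : ℤ), VA.proj h u = u → ∀ (k : ℤ) (v : V),
      VA'.Y u (-k - 1) v = ∑ᶠ m : ℤ, tcoef h m k • VA.Y u m v) :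
    (∀ M : QuasiMod VA ρ χ W, ∃! M' : PhiMod VA' ρ χ W,
        ∀ (v : V) (h : ℤ), VA.proj h v = v → ∀ n : ℤ, M'.E v n = M.A v (n - h)) ∧
    (∀ M' : PhiMod VA' ρ χ W, ∃! M : QuasiMod VA ρ χ W,
        ∀ (v : V) (h : ℤ), VA.proj h v = v → ∀ n : ℤ, M'.E v n = M.A v (n - h)) := by
  have hρ' := fun g => (hρ g).2
  refine ⟨fun M => ⟨M.toPhiMod hρ' hone hY', fun v h hv n => ?_, fun M' hM' => ?_⟩,
    fun M' => ⟨M'.toQuasiMod hρ' hone hY', fun v h hv n => ?_, fun M hM => ?_⟩⟩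
  · refine (GradedVA.degShift_of_proj M.isLinearFamily (-1) hv n).trans ?_
    rw [neg_one_mul, ← sub_eq_add_neg]
  · refine PhiMod.eq_of_E_eq (GradedVA.eq_of_eq_on_homogeneous (VA := VA) M'.isLinearFamily
      (PhiMod.isLinearFamily _) fun v h hv n => ?_)
    refine (hM' v h hv n).trans (Eq.trans ?_
      (GradedVA.degShift_of_proj M.isLinearFamily (-1) hv n).symm)
    rw [neg_one_mul, ← sub_eq_add_neg]
  · refine Eq.trans ?_ (GradedVA.degShift_of_proj M'.isLinearFamily 1 hv (n - h)).symm
    rw [one_mul, sub_add_cancel]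
  · refine QuasiMod.eq_of_A_eq (GradedVA.eq_of_eq_on_homogeneous (VA := VA) M.isLinearFamily
      (QuasiMod.isLinearFamily _) fun v h hv n => ?_)
    refine Eq.trans ?_ (GradedVA.degShift_of_proj M'.isLinearFamily 1 hv n).symm
    rw [hM v h hv, one_mul, add_sub_cancel_right]

end
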